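/- Let A be a unital associative ℂ-algebra, σ : A → A an algebra automorphism, δ₁, δ₂ : A → A two σ-derivations, and τ : A → ℂ a σ²-trace with τ ∘ σ = τ, τ ∘ δ₁ = 0 and τ ∘ δ₂ = 0. Let m, n ≥ 0 and P, Q ≥ 1 be integers with m − P + 1 ≥ 0 and n − Q + 1 ≥ 0. Then for all a, b ∈ A: τ(a · P_{Q−1, n}(σ, δ₂) ∘ P_{P−1, m}(σ, δ₁)(b)) = (−1)^{(n−Q+1)+(m−P+1)} · Σ τ(b · (σ⁻¹∘(δ₁∘σ⁻¹)^{j₁}) ∘ ⋯ ∘ (σ⁻¹∘(δ₁∘σ⁻¹)^{j_P}) ∘ (σ⁻¹∘(δ₂∘σ⁻¹)^{i₁}) ∘ ⋯ ∘ (σ⁻¹∘(δ₂∘σ⁻¹)^{i_Q})(a)), where the sum is over all tuples of non-negative integers i = (i₁,…,i_Q) with i₁+⋯+i_Q = n−Q+1 and j = (j₁,…,j_P) with j₁+⋯+j_P = m−P+1. (This is the identity res(a ξ₁^m ξ₂^n b ξ₁^{−P} ξ₂^{−Q}) = res(b ξ₁^{−P} ξ₂^{−Q} a ξ₁^m ξ₂^n)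 at the level of coefficients, used to show the residue is a trace on the two-dimensional algebra of twisted pseudodifferential symbols.) -/

import Mathlib

open Function

/-- The composite `(g ∘ (d ∘ g)^[i₁]) ∘ (g ∘ (d ∘ g)^[i₂]) ∘ ⋯ ∘ (g ∘ (d ∘ g)^[i_m])`
associated to a list `[i₁, …, i_m]`. (In applications `g = σ⁻¹`, `d = δ`.) -/
def leftComp {A : Type*} (g d : A → A) : List ℕ → (A → A)
  | [] => id
  | i :: t => (g ∘ (d ∘ g)^[i]) ∘ leftComp g d t

/-- The composite map associated to a word in two letters: `true` stands for `s`
and `false` stands for `d`, the first letter of the list acting last (outermost). -/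
def wordMap {A : Type*} (s d : A → A) (w : List Bool) : A → A :=
  w.foldr (fun b f => (if b then s else d) ∘ f) id

/-- `Pmap s d i n` is `P_{i,n}(s,d)`: the sum, over all words of length `n` in the two
letters `s` and `d` containing exactly `i` occurrences of `s`, of the corresponding
composite map.  E.g. `P_{3,4}(σ,δ) = δσ³ + σδσ² + σ²δσ + σ³δ`. -/
noncomputable def Pmap {A : Type*} [AddCommMonoid A] (s d : A → A) (i n : ℕ) : A → A :=
  ∑ w ∈ Finset.univ.filter (fun w : Fin n → Bool => (List.ofFn w).count true = i),
    wordMap s d (List.ofFn w)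

section Counting

open Finset

lemma count_true_ofFn {n : ℕ} (w : Fin n → Bool) :
    (List.ofFn w).count true = #{k | w k = true} := by
  have h := Fin.card_filter_univ_eq_vector_get_eq_count true (List.Vector.ofFn w)
  simpa only [List.Vector.get_ofFn, List.Vector.toList_ofFn] using h.symm

lemma count_false_ofFn {n : ℕ} (w : Fin n → Bool) :
    (List.ofFn w).count false = n - (List.ofFn w).count true := by
  have h := List.count_not_add_count (List.ofFn w) true
  simp only [Bool.not_true, List.length_ofFn] at h
  omega

lemma card_words (n i : ℕ) :
    #{w : Fin n → Bool | (List.ofFn w).count true = i} = n.choose i := by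
  rw [← Finset.card_fin n, ← card_powersetCard, card_fin]
  refine card_bij' (fun w _ => ({k | w k = true} : Finset (Fin n)))
    (fun s _ k => decide (k ∈ s)) ?_ ?_ ?_ ?_
  · intro w hw
    simpa [mem_powersetCard, count_true_ofFn] using hw
  · intro s hs
    simpa [mem_powersetCard, count_true_ofFn] using hs
  · intro w _
    simp
  · intro s _
    simp

lemma card_antidiagonalTuple_succ (k n : ℕ) :
    #(Finset.Nat.antidiagonalTuple (k + 1) n) = (k + n).choose k := by
  have h := card_finsuppAntidiag_nat_eq_choose (s := (univ : Finset (Fin (k + 1)))) n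
  rw [card_fin, Nat.add_right_comm, Nat.add_sub_cancel, ← Nat.choose_symm_add] at h
  rw [← h]
  refine card_equiv Finsupp.equivFunOnFinite.symm fun f => ?_
  simp [Finset.Nat.mem_antidiagonalTuple]

end Counting

section CommuteModulo

variable {A V : Type*} {π : A → V} {s d : A → A}

lemma map_iterate_congr (hs : ∀ x y, π x = π y → π (s x) = π (s y)) (k : ℕ) {x y : A}
    (h : π x = π y) : π (s^[k] x) = π (s^[k] y) := by
  induction k generalizing x y with
  | zero => exact h
  | succ k ih => exact ih (hs _ _ h)

lemma map_apply_iterate_comm (hs : ∀ x y, π x = π y → π (s x) = π (s y))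
    (hsd : ∀ x, π (d (s x)) = π (s (d x))) (k : ℕ) (x : A) :
    π (d (s^[k] x)) = π (s^[k] (d x)) := by
  induction k generalizing x with
  | zero => rfl
  | succ k ih =>
    rw [iterate_succ_apply, ih, iterate_succ_apply]
    exact map_iterate_congr hs k (hsd x)

lemma map_iterate_iterate_comm (hs : ∀ x y, π x = π y → π (s x) = π (s y))
    (hd : ∀ x y, π x = π y → π (d x) = π (d y))
    (hsd : ∀ x, π (d (s x)) = π (s (d x))) (k l : ℕ) (x : A) :
    π (d^[l] (s^[k] x)) = π (s^[k] (d^[l] x)) := by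
  induction l generalizing x with
  | zero => rfl
  | succ l ih =>
    rw [iterate_succ_apply, map_iterate_congr hd l (map_apply_iterate_comm hs hsd k x), ih,
      iterate_succ_apply]

lemma map_wordMap (hs : ∀ x y, π x = π y → π (s x) = π (s y))
    (hd : ∀ x y, π x = π y → π (d x) = π (d y))
    (hsd : ∀ x, π (d (s x)) = π (s (d x))) (w : List Bool) (x : A) :
    π (wordMap s d w x) = π (s^[w.count true] (d^[w.count false] x)) := by
  induction w with
  | nil => rfl
  | cons c w ih =>
    cases c
    · have h : wordMap s d (false :: w) x = d (wordMap s d w x) := rfl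
      rw [h, hd _ _ ih, map_apply_iterate_comm hs hsd, ← iterate_succ_apply' d]
      simp
    · have h : wordMap s d (true :: w) x = s (wordMap s d w x) := rfl
      rw [h, hs _ _ ih, ← iterate_succ_apply' s]
      simp

lemma map_comp_iterate (hs : ∀ x y, π x = π y → π (s x) = π (s y))
    (hd : ∀ x y, π x = π y → π (d x) = π (d y))
    (hsd : ∀ x, π (d (s x)) = π (s (d x))) (i : ℕ) (x : A) :
    π ((d ∘ s)^[i] x) = π (s^[i] (d^[i] x)) := by
  induction i with
  | zero => rfl
  | succ i ih =>
    rw [iterate_succ_apply', comp_apply, hd _ _ (hs _ _ ih), ← iterate_succ_apply' s,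
      map_apply_iterate_comm hs hsd, ← iterate_succ_apply' d]

lemma map_leftComp (hs : ∀ x y, π x = π y → π (s x) = π (s y))
    (hd : ∀ x y, π x = π y → π (d x) = π (d y))
    (hsd : ∀ x, π (d (s x)) = π (s (d x))) (l : List ℕ) (x : A) :
    π (leftComp s d l x) = π (s^[l.length + l.sum] (d^[l.sum] x)) := by
  induction l with
  | nil => rfl
  | cons i l ih =>
    have h : leftComp s d (i :: l) x = s ((d ∘ s)^[i] (leftComp s d l x)) := rfl
    rw [h, hs _ _ (map_comp_iterate hs hd hsd i _), ← iterate_succ_apply' s,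
      map_iterate_congr hs _ (map_iterate_congr hd _ ih),
      map_iterate_congr hs _ (map_iterate_iterate_comm hs hd hsd _ _ _),
      ← iterate_add_apply, ← iterate_add_apply, List.length_cons, List.sum_cons]
    rw [show (l.length + 1 + (i + l.sum)) = i + 1 + (l.length + l.sum) by omega]

end CommuteModulo

section TwistedTrace

variable {A : Type*} [Ring A] [Algebra ℂ A]

/-- The map sending `x` to the functional `b ↦ τ (b * x)`. -/
def rightPairing (τ : A →ₗ[ℂ] ℂ) : A →ₗ[ℂ] A →ₗ[ℂ] ℂ :=
  ((LinearMap.mul ℂ A).compr₂ τ).flip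

@[simp]
lemma rightPairing_apply (τ : A →ₗ[ℂ] ℂ) (x b : A) : rightPairing τ x b = τ (b * x) := rfl

variable {σ : A ≃ₐ[ℂ] A} {δ : A →ₗ[ℂ] A} {τ : A →ₗ[ℂ] ℂ}

lemma trace_mul_sigma (hτσ : ∀ a, τ (σ a) = τ a) (a b : A) :
    τ (a * σ b) = τ (σ.symm a * b) := by
  rw [← hτσ (σ.symm a * b), map_mul σ, AlgEquiv.apply_symm_apply]

lemma trace_mul_symm (hτσ : ∀ a, τ (σ a) = τ a) (a b : A) :
    τ (a * σ.symm b) = τ (σ a * b) := by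
  rw [← hτσ (a * σ.symm b), map_mul σ, AlgEquiv.apply_symm_apply]

lemma trace_mul_derivation (hδ : ∀ a b, δ (a * b) = δ a * b + σ a * δ b)
    (hτδ : ∀ a, τ (δ a) = 0) (a b : A) :
    τ (a * δ b) = -τ (δ (σ.symm a) * b) := by
  have h := hτδ (σ.symm a * b)
  rw [hδ, map_add, AlgEquiv.apply_symm_apply] at h
  linear_combination h

lemma trace_mul_sigma_iterate (hτσ : ∀ a, τ (σ a) = τ a) (k : ℕ) (a b : A) :
    τ (a * σ^[k] b) = τ (σ.symm^[k] a * b) := by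
  induction k generalizing a with
  | zero => rfl
  | succ k ih => rw [iterate_succ_apply', trace_mul_sigma hτσ, ih, iterate_succ_apply]

lemma trace_mul_derivation_iterate (hδ : ∀ a b, δ (a * b) = δ a * b + σ a * δ b)
    (hτδ : ∀ a, τ (δ a) = 0) (k : ℕ) (a b : A) :
    τ (a * δ^[k] b) = (-1) ^ k * τ ((δ ∘ σ.symm)^[k] a * b) := by
  induction k generalizing a with
  | zero => simp
  | succ k ih =>
    rw [iterate_succ_apply', trace_mul_derivation hδ hτδ, ih, iterate_succ_apply, comp_apply]
    ring

lemma trace_mul_comm_symm (hτ : ∀ a b, τ (a * b) = τ (σ (σ b) * a)) (a b : A) :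
    τ (a * b) = τ (b * σ.symm (σ.symm a)) := by
  rw [hτ b]
  simp

lemma rightPairing_sigma_congr (hτσ : ∀ a, τ (σ a) = τ a) (x y : A)
    (h : rightPairing τ x = rightPairing τ y) :
    rightPairing τ (σ x) = rightPairing τ (σ y) := by
  ext b
  simpa [trace_mul_sigma hτσ] using LinearMap.congr_fun h (σ.symm b)

lemma rightPairing_symm_congr (hτσ : ∀ a, τ (σ a) = τ a) (x y : A)
    (h : rightPairing τ x = rightPairing τ y) :
    rightPairing τ (σ.symm x) = rightPairing τ (σ.symm y) := by
  ext b
  simpa [trace_mul_symm hτσ] using LinearMap.congr_fun h (σ b)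

lemma rightPairing_derivation_congr (hδ : ∀ a b, δ (a * b) = δ a * b + σ a * δ b)
    (hτδ : ∀ a, τ (δ a) = 0) (x y : A)
    (h : rightPairing τ x = rightPairing τ y) :
    rightPairing τ (δ x) = rightPairing τ (δ y) := by
  ext b
  simpa [trace_mul_derivation hδ hτδ] using LinearMap.congr_fun h (δ (σ.symm b))

/-- A `σ`-derivation annihilated by an invariant `σ²`-trace commutes with `σ⁻¹` modulo the
radical of the trace form. -/
lemma rightPairing_derivation_symm (hδ : ∀ a b, δ (a * b) = δ a * b + σ a * δ b)
    (hτ : ∀ a b, τ (a * b) = τ (σ (σ b) * a)) (hτσ : ∀ a, τ (σ a) = τ a)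
    (hτδ : ∀ a, τ (δ a) = 0) (x : A) :
    rightPairing τ (δ (σ.symm x)) = rightPairing τ (σ.symm (δ x)) := by
  ext b
  simp only [rightPairing_apply]
  have hx : τ (σ (δ (σ.symm b)) * x) = τ (σ x * δ (σ.symm b)) := by
    rw [hτ, ← map_mul σ, hτσ]
  rw [trace_mul_derivation hδ hτδ, trace_mul_symm hτσ, trace_mul_symm hτσ, hx,
    trace_mul_derivation hδ hτδ, neg_neg, AlgEquiv.symm_apply_apply, trace_mul_comm_symm hτ (σ b),
    AlgEquiv.symm_apply_apply]

lemma rightPairing_derivation_sigma (hδ : ∀ a b, δ (a * b) = δ a * b + σ a * δ b)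
    (hτ : ∀ a b, τ (a * b) = τ (σ (σ b) * a)) (hτσ : ∀ a, τ (σ a) = τ a)
    (hτδ : ∀ a, τ (δ a) = 0) (x : A) :
    rightPairing τ (δ (σ x)) = rightPairing τ (σ (δ x)) := by
  have h := rightPairing_derivation_symm hδ hτ hτσ hτδ (σ x)
  have h' := rightPairing_sigma_congr hτσ _ _ h
  simpa using h'.symm

lemma trace_mul_Pmap (hδ : ∀ a b, δ (a * b) = δ a * b + σ a * δ b)
    (hτ : ∀ a b, τ (a * b) = τ (σ (σ b) * a)) (hτσ : ∀ a, τ (σ a) = τ a)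
    (hτδ : ∀ a, τ (δ a) = 0) (p k : ℕ) (a x : A) :
    τ (a * Pmap σ δ p (p + k) x) =
      (p + k).choose p * ((-1) ^ k * τ ((δ ∘ σ.symm)^[k] (σ.symm^[p] a) * x)) := by
  rw [← trace_mul_derivation_iterate hδ hτδ, ← trace_mul_sigma_iterate hτσ, Pmap,
    Finset.sum_apply, Finset.mul_sum, map_sum, ← card_words, ← nsmul_eq_mul]
  refine Finset.sum_eq_card_nsmul fun w hw => ?_
  have hw' := (Finset.mem_filter.1 hw).2
  have h := map_wordMap (rightPairing_sigma_congr hτσ)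
    (rightPairing_derivation_congr hδ hτδ) (rightPairing_derivation_sigma hδ hτ hτσ hτδ)
    (List.ofFn w) x
  rw [count_false_ofFn, hw', Nat.add_sub_cancel_left] at h
  exact LinearMap.congr_fun h a

lemma rightPairing_leftComp (hδ : ∀ a b, δ (a * b) = δ a * b + σ a * δ b)
    (hτ : ∀ a b, τ (a * b) = τ (σ (σ b) * a)) (hτσ : ∀ a, τ (σ a) = τ a)
    (hτδ : ∀ a, τ (δ a) = 0) {p k : ℕ} {j : Fin p → ℕ}
    (hj : j ∈ Finset.Nat.antidiagonalTuple p k) (x : A) :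
    rightPairing τ (leftComp σ.symm δ (List.ofFn j) x) =
      rightPairing τ (σ.symm^[p + k] (δ^[k] x)) := by
  rw [map_leftComp (rightPairing_symm_congr hτσ) (rightPairing_derivation_congr hδ hτδ)
    (rightPairing_derivation_symm hδ hτ hτσ hτδ), List.length_ofFn, List.sum_ofFn,
    Finset.Nat.mem_antidiagonalTuple.1 hj]

end TwistedTrace

/-- Theorem 4.2, case 1, at the level of coefficients. For two
`σ`-derivations `δ₁, δ₂` and an invariant `σ²`-trace `τ`, with `m, n ≥ 0`, `P, Q ≥ 1`,
`k₁ = m - P + 1 ≥ 0`, `k₂ = n - Q + 1 ≥ 0`: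
`τ (a ⬝ P_{Q-1,n}(σ,δ₂) P_{P-1,m}(σ,δ₁)(b)) = (-1)^{k₂+k₁} ∑ τ (b ⬝ σ⁻¹(δ₁σ⁻¹)^{j₁} ⋯
  σ⁻¹(δ₁σ⁻¹)^{j_P} σ⁻¹(δ₂σ⁻¹)^{i₁} ⋯ σ⁻¹(δ₂σ⁻¹)^{i_Q}(a))`,
the sum being over tuples `j` summing to `k₁` and `i` summing to `k₂`. -/
theorem multidim_residue_trace_identity
    {A : Type*} [Ring A] [Algebra ℂ A]
    (σ : A ≃ₐ[ℂ] A) (δ₁ δ₂ : A →ₗ[ℂ] A) (τ : A →ₗ[ℂ] ℂ)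
    (hδ₁ : ∀ a b : A, δ₁ (a * b) = δ₁ a * b + σ a * δ₁ b)
    (hδ₂ : ∀ a b : A, δ₂ (a * b) = δ₂ a * b + σ a * δ₂ b)
    (hτ : ∀ a b : A, τ (a * b) = τ (σ (σ b) * a))
    (hτσ : ∀ a : A, τ (σ a) = τ a)
    (hτδ₁ : ∀ a : A, τ (δ₁ a) = 0)
    (hτδ₂ : ∀ a : A, τ (δ₂ a) = 0)
    (m n P Q k₁ k₂ : ℕ) (hP : 1 ≤ P) (hQ : 1 ≤ Q)
    (hm : m + 1 = k₁ + P) (hn : n + 1 = k₂ + Q) :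
    ∀ a b : A,
      τ (a * Pmap (⇑σ) (⇑δ₂) (Q - 1) n (Pmap (⇑σ) (⇑δ₁) (P - 1) m b))
        = (-1 : ℂ) ^ (k₂ + k₁)
            * ∑ j ∈ Finset.Nat.antidiagonalTuple P k₁,
                ∑ i ∈ Finset.Nat.antidiagonalTuple Q k₂,
                  τ (b * leftComp (⇑σ.symm) (⇑δ₁) (List.ofFn j)
                        (leftComp (⇑σ.symm) (⇑δ₂) (List.ofFn i) a)) := by
  intro a b
  obtain ⟨p, rfl⟩ := Nat.exists_eq_add_of_le' hP
  obtain ⟨q, rfl⟩ := Nat.exists_eq_add_of_le' hQ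
  obtain rfl : m = p + k₁ := by omega
  obtain rfl : n = q + k₂ := by omega
  have hs := rightPairing_symm_congr (σ := σ) hτσ
  have hd₁ := rightPairing_derivation_congr hδ₁ hτδ₁
  have hd₂ := rightPairing_derivation_congr hδ₂ hτδ₂
  have hsd₁ := rightPairing_derivation_symm hδ₁ hτ hτσ hτδ₁
  have hsd₂ := rightPairing_derivation_symm hδ₂ hτ hτσ hτδ₂
  set g : A → A := ⇑σ.symm with hg
  have hL : rightPairing τ (g (g ((δ₁ ∘ g)^[k₁] (g^[p] ((δ₂ ∘ g)^[k₂] (g^[q] a)))))) =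
      rightPairing τ (g^[(p + 1) + k₁ + ((q + 1) + k₂)] (δ₁^[k₁] (δ₂^[k₂] a))) := by
    have h₂ : rightPairing τ ((δ₂ ∘ g)^[k₂] (g^[q] a)) =
        rightPairing τ (g^[k₂ + q] (δ₂^[k₂] a)) := by
      rw [map_comp_iterate hs hd₂ hsd₂,
        map_iterate_congr hs _ (map_iterate_iterate_comm hs hd₂ hsd₂ _ _ _),
        ← iterate_add_apply]
    rw [hs _ _ (hs _ _ (map_comp_iterate hs hd₁ hsd₁ _ _)), ← iterate_succ_apply' g,
      ← iterate_succ_apply' g,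
      map_iterate_congr hs _ (map_iterate_congr hd₁ _ (map_iterate_congr hs p h₂)),
      ← iterate_add_apply g p,
      map_iterate_congr hs _ (map_iterate_iterate_comm hs hd₁ hsd₁ _ _ _),
      ← iterate_add_apply]
    rw [show p + 1 + k₁ + (q + 1 + k₂) = k₁ + 1 + 1 + (p + (k₂ + q)) by omega]
  have hR : ∀ j ∈ Finset.Nat.antidiagonalTuple (p + 1) k₁,
      ∀ i ∈ Finset.Nat.antidiagonalTuple (q + 1) k₂,
      τ (b * leftComp g δ₁ (List.ofFn j) (leftComp g δ₂ (List.ofFn i) a)) =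
        τ (b * g^[(p + 1) + k₁ + ((q + 1) + k₂)] (δ₁^[k₁] (δ₂^[k₂] a))) := by
    intro j hj i hi
    refine LinearMap.congr_fun (f := rightPairing τ _) (g := rightPairing τ _) ?_ b
    rw [rightPairing_leftComp hδ₁ hτ hτσ hτδ₁ hj,
      map_iterate_congr hs _ (map_iterate_congr hd₁ _
        (rightPairing_leftComp hδ₂ hτ hτσ hτδ₂ hi a)),
      map_iterate_congr hs _ (map_iterate_iterate_comm hs hd₁ hsd₁ _ _ _),
      ← iterate_add_apply]
  rw [Finset.sum_congr rfl fun j hj => Finset.sum_congr rfl fun i hi => hR j hj i hi]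
  simp only [Finset.sum_const, card_antidiagonalTuple_succ, nsmul_eq_mul, Nat.add_sub_cancel]
  rw [trace_mul_Pmap hδ₂ hτ hτσ hτδ₂, trace_mul_Pmap hδ₁ hτ hτσ hτδ₁, trace_mul_comm_symm hτ]
  have h := LinearMap.congr_fun hL b
  simp only [rightPairing_apply] at h
  rw [← hg, h]
  ring
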